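/- (One iteration of OMPR(l), noiseless case.) Let x* ∈ ℝ^n be k-sparse and b = Ax*. Suppose A satisfies the RIP of order 2k with constant δ_{2k} and of order 2l with constant δ_{2l}, and let η > 0 satisfy η(1+δ_{2l}) < 1 and η(1−δ_{2k}) > 1/2. Let x^t be a least-squares solution on a support I_t with |I_t| = k and f(x^t) > 0. Set z = x^t − η Aᵀ(Ax^t − b). Let 1 ≤ l ≤ k, let L ⊆ I_tᶜ with |L| = l satisfy |z_j| ≥ |z_{j'}| for all j ∈ L, j' ∈ I_tᶜ\L, let S ⊆ I_t ∪ L with |S| = k satisfy |z_j| ≥ |z_{j'}| for all j ∈ S, j' ∈ (I_t ∪ L)\S, and let x^{t+1} be a least-squares solution on S. Then f(x^{t+1}) ≤ (1 − α l/k) f(x^t), where α = c (1/η − (1+δ_{2l})) > 0 and c = min(4η(1−η)², 2(2η − 1/(1−δ_{2k}))). -/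

import Mathlib

open Finset Matrix

noncomputable def nrm {d : ℕ} (x : Fin d → ℝ) : ℝ := Real.sqrt (∑ i, (x i)^2)

noncomputable def supp {d : ℕ} (x : Fin d → ℝ) : Finset (Fin d) := Finset.univ.filter (fun i => x i ≠ 0)

def restr {d : ℕ} (x : Fin d → ℝ) (I : Finset (Fin d)) : Fin d → ℝ := fun i => if i ∈ I then x i else 0

noncomputable def dotp {d : ℕ} (x y : Fin d → ℝ) : ℝ := ∑ i, x i * y i

def RIP {m n : ℕ} (A : Matrix (Fin m) (Fin n) ℝ) (s : ℕ) (δ : ℝ) : Prop :=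
  0 ≤ δ ∧ δ < 1 ∧ ∀ x : Fin n → ℝ, (supp x).card ≤ s →
    (1 - δ) * (nrm x)^2 ≤ (nrm (A.mulVec x))^2 ∧ (nrm (A.mulVec x))^2 ≤ (1 + δ) * (nrm x)^2

def lsSol {m n : ℕ} (A : Matrix (Fin m) (Fin n) ℝ) (b : Fin m → ℝ) (I : Finset (Fin n)) (x : Fin n → ℝ) : Prop :=
  supp x ⊆ I ∧ ∀ i ∈ I, Aᵀ.mulVec (A.mulVec x - b) i = 0

noncomputable def obj {m n : ℕ} (A : Matrix (Fin m) (Fin n) ℝ) (b : Fin m → ℝ) (x : Fin n → ℝ) : ℝ :=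
  (1/2) * (nrm (A.mulVec x - b))^2

theorem nrm_sq {d : ℕ} (x : Fin d → ℝ) : (nrm x)^2 = ∑ i, (x i)^2 :=
  Real.sq_sqrt (Finset.sum_nonneg fun _ _ => sq_nonneg _)

theorem nrm_sq_eq_dotProduct {d : ℕ} (x : Fin d → ℝ) : (nrm x)^2 = x ⬝ᵥ x := by
  rw [nrm_sq]
  exact Finset.sum_congr rfl fun i _ => sq (x i)

theorem eq_zero_of_supp_subset {d : ℕ} {x : Fin d → ℝ} {I : Finset (Fin d)} (h : supp x ⊆ I)
    {i : Fin d} (hi : i ∉ I) : x i = 0 := by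
  by_contra hx
  exact hi (h (by simp [supp, hx]))

theorem supp_subset_of_eq_zero {d : ℕ} {x : Fin d → ℝ} {I : Finset (Fin d)}
    (h : ∀ i, i ∉ I → x i = 0) : supp x ⊆ I := by
  intro i hi
  by_contra hI
  exact (Finset.mem_filter.mp hi).2 (h i hI)

/-- The quadratic expansion of the least-squares objective. -/
theorem obj_eq_add {m n : ℕ} (A : Matrix (Fin m) (Fin n) ℝ) (b : Fin m → ℝ) (x y : Fin n → ℝ) :
    obj A b y = obj A b x + Aᵀ.mulVec (A.mulVec x - b) ⬝ᵥ (y - x)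
      + (1/2) * (nrm (A.mulVec (y - x)))^2 := by
  have h1 : A.mulVec y - b = (A.mulVec x - b) + A.mulVec (y - x) := by
    rw [Matrix.mulVec_sub]; abel
  have h2 : Aᵀ.mulVec (A.mulVec x - b) ⬝ᵥ (y - x) = (A.mulVec x - b) ⬝ᵥ A.mulVec (y - x) := by
    rw [Matrix.mulVec_transpose, Matrix.dotProduct_mulVec]
  unfold obj
  rw [h2, nrm_sq_eq_dotProduct, nrm_sq_eq_dotProduct, nrm_sq_eq_dotProduct, h1]
  simp only [add_dotProduct, dotProduct_add]
  rw [dotProduct_comm (A.mulVec (y - x)) (A.mulVec x - b)]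
  ring

/-- A least-squares solution on `I` minimizes the objective among vectors supported on `I`. -/
theorem lsSol.obj_le {m n : ℕ} {A : Matrix (Fin m) (Fin n) ℝ} {b : Fin m → ℝ}
    {I : Finset (Fin n)} {x y : Fin n → ℝ} (hx : lsSol A b I x) (hy : supp y ⊆ I) :
    obj A b x ≤ obj A b y := by
  have h : Aᵀ.mulVec (A.mulVec x - b) ⬝ᵥ (y - x) = 0 := by
    refine Finset.sum_eq_zero fun i _ => ?_
    by_cases hi : i ∈ I
    · rw [hx.2 i hi, zero_mul]
    · simp [eq_zero_of_supp_subset hx.1 hi, eq_zero_of_supp_subset hy hi]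
  rw [obj_eq_add A b x y, h]
  nlinarith [sq_nonneg (nrm (A.mulVec (y - x)))]

/-- If `T` collects the largest values of `v` on `U`, then a uniformly weighted sum over `W ⊆ U`
of total weight at most `#T` is at most the sum over `T`. -/
theorem mul_sum_le_sum_of_top {ι : Type*} [DecidableEq ι] {v : ι → ℝ} (hv : ∀ i, 0 ≤ v i)
    {T U W : Finset ι} (htop : ∀ j ∈ T, ∀ j' ∈ U \ T, v j' ≤ v j) (hWU : W ⊆ U)
    {ρ : ℝ} (h0 : 0 ≤ ρ) (h1 : ρ ≤ 1) (hcard : ρ * (W.card : ℝ) ≤ T.card) :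
    ρ * ∑ i ∈ W, v i ≤ ∑ i ∈ T, v i := by
  obtain rfl | hT := T.eq_empty_or_nonempty
  · obtain rfl | hW := W.eq_empty_or_nonempty
    · simp
    · have hpos : (0 : ℝ) < W.card := by exact_mod_cast hW.card_pos
      have hρ : ρ = 0 := by
        simp only [Finset.card_empty, Nat.cast_zero] at hcard
        nlinarith
      simp [hρ]
  obtain ⟨a, haT, ha⟩ := T.exists_min_image v hT
  have e1 : ∑ i ∈ W ∩ T, (v i - v a) ≤ ∑ i ∈ T, (v i - v a) :=
    Finset.sum_le_sum_of_subset_of_nonneg Finset.inter_subset_right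
      fun i hi _ => sub_nonneg.mpr (ha i hi)
  have e2 : 0 ≤ ∑ i ∈ W ∩ T, (v i - v a) :=
    Finset.sum_nonneg fun i hi => sub_nonneg.mpr (ha i (Finset.mem_inter.mp hi).2)
  have e3 : ∑ i ∈ W \ T, (v i - v a) ≤ 0 := Finset.sum_nonpos fun i hi => by
    rw [Finset.mem_sdiff] at hi
    exact sub_nonpos.mpr (htop a haT i (Finset.mem_sdiff.mpr ⟨hWU hi.1, hi.2⟩))
  have e4 := Finset.sum_inter_add_sum_sdiff W T fun i => v i - v a
  have e5 : ρ * ∑ i ∈ W, (v i - v a) ≤ ∑ i ∈ T, (v i - v a) := by nlinarith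
  simp only [Finset.sum_sub_distrib, Finset.sum_const, nsmul_eq_mul] at e5
  nlinarith [mul_le_mul_of_nonneg_right hcard (hv a)]

/-- For a least-squares solution `x` on `I` in the noiseless case, the energy of the gradient step
on the true support exceeds the energy on `I` by a multiple of the objective. -/
theorem obj_le_sum_sq_sub_sum_sq {m n k : ℕ} {A : Matrix (Fin m) (Fin n) ℝ}
    {xstar x : Fin n → ℝ} {I : Finset (Fin n)} (hsp : (supp xstar).card ≤ k) (hI : I.card = k)
    {δ : ℝ} (hRIP : RIP A (2*k) δ) (hx : lsSol A (A.mulVec xstar) I x) (η : ℝ)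
    {z : Fin n → ℝ}
    (hz : z = fun i => x i - η * Aᵀ.mulVec (A.mulVec x - A.mulVec xstar) i) :
    2 * (2*η - 1/(1-δ)) * obj A (A.mulVec xstar) x
      ≤ ∑ i ∈ supp xstar, (z i)^2 - ∑ i ∈ I, (z i)^2 := by
  obtain ⟨-, hδ, hR⟩ := hRIP
  set g := Aᵀ.mulVec (A.mulVec x - A.mulVec xstar) with hg
  have hsupp : supp (x - xstar) ⊆ I ∪ supp xstar := supp_subset_of_eq_zero fun i hi => by
    rw [Finset.mem_union, not_or] at hi
    simp [eq_zero_of_supp_subset hx.1 hi.1,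
      eq_zero_of_supp_subset (Finset.Subset.refl (supp xstar)) hi.2]
  have hcard : (supp (x - xstar)).card ≤ 2*k :=
    (Finset.card_le_card hsupp).trans ((Finset.card_union_le _ _).trans (by omega))
  have hlow := (hR _ hcard).1
  have hobj : (nrm (A.mulVec (x - xstar)))^2 = 2 * obj A (A.mulVec xstar) x := by
    rw [obj, Matrix.mulVec_sub]; ring
  have hgrad : ∑ i, g i * (x i - xstar i) = 2 * obj A (A.mulVec xstar) x := by
    rw [← hobj, nrm_sq_eq_dotProduct, Matrix.dotProduct_mulVec, ← Matrix.mulVec_transpose,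
      Matrix.mulVec_sub A]
    rfl
  have hpt : ∀ i, 2*η * (g i * (x i - xstar i)) ≤ (if i ∈ supp xstar then (z i)^2 else 0)
      - (if i ∈ I then (z i)^2 else 0) + ((x - xstar) i)^2 := by
    intro i
    have hzi : z i = x i - η * g i := by rw [hz]
    rw [Pi.sub_apply]
    by_cases h1 : i ∈ I
    · have hgi : g i = 0 := hx.2 i h1
      by_cases h2 : i ∈ supp xstar
      · simp only [h1, h2, if_true, hgi]
        nlinarith [sq_nonneg (x i - xstar i)]
      · have := eq_zero_of_supp_subset (Finset.Subset.refl _) h2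
        simp only [h1, h2, if_true, if_false, hgi, hzi, this]
        nlinarith
    · have hxi := eq_zero_of_supp_subset hx.1 h1
      by_cases h2 : i ∈ supp xstar
      · simp only [h1, h2, if_true, if_false, hzi, hxi]
        nlinarith [sq_nonneg (η * g i + xstar i)]
      · have := eq_zero_of_supp_subset (Finset.Subset.refl _) h2
        simp only [h1, h2, if_false, hxi, this]
        nlinarith
  have hsum := Finset.sum_le_sum fun i (_ : i ∈ Finset.univ) => hpt i
  rw [← Finset.mul_sum, hgrad, Finset.sum_add_distrib, Finset.sum_sub_distrib,
    Finset.sum_ite_mem, Finset.sum_ite_mem, Finset.univ_inter, Finset.univ_inter,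
    ← nrm_sq] at hsum
  have hdiv : (nrm (x - xstar))^2 ≤ 1/(1-δ) * (2 * obj A (A.mulVec xstar) x) := by
    rw [one_div_mul_eq_div, le_div_iff₀ (by linarith), ← hobj]
    linarith
  nlinarith

/-- Replacing the support `I` by `S` and truncating the gradient step to `S` decreases the
objective in proportion to the energy on the newly selected indices. -/
theorem obj_restr_le {m n l : ℕ} {A : Matrix (Fin m) (Fin n) ℝ} {b : Fin m → ℝ}
    {x : Fin n → ℝ} {I S : Finset (Fin n)} {δ η : ℝ} (hRIP : RIP A (2*l) δ) (hη : 0 < η)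
    (hx : lsSol A b I x) {z : Fin n → ℝ}
    (hz : z = fun i => x i - η * Aᵀ.mulVec (A.mulVec x - b) i)
    (hcard : (I \ S).card + (S \ I).card ≤ 2*l)
    (hle : ∑ i ∈ I \ S, (z i)^2 ≤ ∑ i ∈ S \ I, (z i)^2) :
    obj A b (restr z S) ≤ obj A b x - (1/η - (1 + δ)) * ∑ i ∈ S \ I, (z i)^2 := by
  obtain ⟨hδ, -, hR⟩ := hRIP
  set g := Aᵀ.mulVec (A.mulVec x - b) with hg
  have hzi : ∀ i, z i = x i - η * g i := fun i => by rw [hz]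
  have hgI : ∀ i ∈ I, g i = 0 := hx.2
  have hd : ∀ i, (restr z S - x) i
      = if i ∈ S \ I then z i else if i ∈ I \ S then - z i else 0 := by
    intro i
    rw [Pi.sub_apply, restr]
    by_cases h1 : i ∈ I <;> by_cases h2 : i ∈ S
    · simp [h1, h2, hzi, hgI i h1]
    · simp [h1, h2, hzi, hgI i h1]
    · simp [h1, h2, eq_zero_of_supp_subset hx.1 h1]
    · simp [h1, h2, eq_zero_of_supp_subset hx.1 h1]
  have hsupp : supp (restr z S - x) ⊆ (I \ S) ∪ (S \ I) :=
    supp_subset_of_eq_zero fun i hi => by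
      rw [Finset.mem_union, not_or] at hi
      rw [hd, if_neg hi.2, if_neg hi.1]
  have hup := (hR _ ((Finset.card_le_card hsupp).trans
    ((Finset.card_union_le _ _).trans hcard))).2
  have hnorm : (nrm (restr z S - x))^2
      = ∑ i ∈ S \ I, (z i)^2 + ∑ i ∈ I \ S, (z i)^2 := by
    rw [nrm_sq, ← Finset.univ_inter (S \ I), ← Finset.univ_inter (I \ S),
      ← Finset.sum_ite_mem, ← Finset.sum_ite_mem, ← Finset.sum_add_distrib]
    refine Finset.sum_congr rfl fun i _ => ?_
    rw [hd]
    by_cases h1 : i ∈ I <;> by_cases h2 : i ∈ S <;> simp [h1, h2]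
  have hgrad : g ⬝ᵥ (restr z S - x) = - (1/η * ∑ i ∈ S \ I, (z i)^2) := by
    rw [← Finset.univ_inter (S \ I), ← Finset.sum_ite_mem, Finset.mul_sum,
      ← Finset.sum_neg_distrib]
    refine Finset.sum_congr rfl fun i _ => ?_
    rw [hd]
    by_cases h1 : i ∈ I
    · simp [h1, hgI i h1]
    · by_cases h2 : i ∈ S
      · simp only [Finset.mem_sdiff, h1, h2, not_false_eq_true, and_self, if_true, hzi,
          eq_zero_of_supp_subset hx.1 h1]
        field_simp
        ring
      · simp [h1, h2]
  rw [obj_eq_add A b x, hgrad]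
  rw [hnorm] at hup
  nlinarith

/-- The energy on the newly selected indices of a top-`k` selection from `I ∪ L`. -/
theorem mul_sum_sub_sum_le_sum_sdiff {ι : Type*} [Fintype ι] [DecidableEq ι] {v : ι → ℝ}
    (hv : ∀ i, 0 ≤ v i) {I L S J : Finset ι} (hJ : J.card ≤ S.card)
    (hLS : L.card ≤ S.card) (hLI : L ⊆ Iᶜ)
    (hL : ∀ j ∈ L, ∀ j' ∈ Iᶜ \ L, v j' ≤ v j)
    (hS : ∀ j ∈ S, ∀ j' ∈ (I ∪ L) \ S, v j' ≤ v j)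
    (hD : 0 ≤ ∑ i ∈ J, v i - ∑ i ∈ I, v i) :
    (L.card : ℝ) / S.card * (∑ i ∈ J, v i - ∑ i ∈ I, v i) ≤ ∑ i ∈ S \ I, v i := by
  have hJS : (J.card : ℝ) ≤ S.card := by exact_mod_cast hJ
  have hLS' : (L.card : ℝ) ≤ S.card := by exact_mod_cast hLS
  have hρ : (L.card : ℝ) / S.card ≤ 1 := div_le_one_of_le₀ hLS' (Nat.cast_nonneg _)
  have hρ0 : (0 : ℝ) ≤ (L.card : ℝ) / S.card := by positivity
  by_cases hsub : L ⊆ S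
  · have h1 : (L.card : ℝ) / S.card * ∑ i ∈ J \ I, v i ≤ ∑ i ∈ L, v i := by
      refine mul_sum_le_sum_of_top hv hL (fun i hi => ?_) hρ0 hρ ?_
      · exact Finset.mem_compl.mpr (Finset.mem_sdiff.mp hi).2
      · have hJI : ((J \ I).card : ℝ) ≤ S.card :=
          le_trans (by exact_mod_cast Finset.card_le_card Finset.sdiff_subset) hJS
        calc (L.card : ℝ) / S.card * (J \ I).card ≤ (L.card : ℝ) / S.card * S.card := by gcongr
          _ ≤ L.card := by
            rw [div_mul_eq_mul_div]
            exact div_le_of_le_mul₀ (by positivity) (by positivity) le_rfl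
    have h2 : ∑ i ∈ L, v i ≤ ∑ i ∈ S \ I, v i :=
      Finset.sum_le_sum_of_subset_of_nonneg
        (fun i hi => Finset.mem_sdiff.mpr ⟨hsub hi, Finset.mem_compl.mp (hLI hi)⟩)
        fun i _ _ => hv i
    have h3 := Finset.sum_inter_add_sum_sdiff J I v
    have h4 : ∑ i ∈ J ∩ I, v i ≤ ∑ i ∈ I, v i :=
      Finset.sum_le_sum_of_subset_of_nonneg Finset.inter_subset_right fun i _ _ => hv i
    refine le_trans (mul_le_mul_of_nonneg_left ?_ hρ0) (h1.trans h2)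
    linarith
  · obtain ⟨a, haL, haS⟩ := Finset.not_subset.mp hsub
    have htop : ∀ j ∈ S, ∀ j' ∈ Finset.univ \ S, v j' ≤ v j := by
      intro j hj j' hj'
      have hj'S := (Finset.mem_sdiff.mp hj').2
      by_cases hmem : j' ∈ I ∪ L
      · exact hS j hj j' (Finset.mem_sdiff.mpr ⟨hmem, hj'S⟩)
      · rw [Finset.mem_union, not_or] at hmem
        exact (hL a haL j' (by simp [hmem])).trans (hS j hj a (by simp [haL, haS]))
    have h1 := mul_sum_le_sum_of_top hv htop (Finset.subset_univ J) zero_le_one le_rfl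
      (by simpa using hJS)
    have h2 := Finset.sum_inter_add_sum_sdiff S I v
    have h3 : ∑ i ∈ S ∩ I, v i ≤ ∑ i ∈ I, v i :=
      Finset.sum_le_sum_of_subset_of_nonneg Finset.inter_subset_right fun i _ _ => hv i
    refine (mul_le_of_le_one_left hD hρ).trans ?_
    linarith

theorem stmt8 {m n k l : ℕ} (A : Matrix (Fin m) (Fin n) ℝ) (xstar : Fin n → ℝ)
    (hsp : (supp xstar).card ≤ k) (b : Fin m → ℝ) (hb : b = A.mulVec xstar)
    (δ2k δ2l : ℝ) (hRIP2k : RIP A (2*k) δ2k) (hRIP2l : RIP A (2*l) δ2l)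
    (η : ℝ) (hη : 0 < η) (hη1 : η * (1 + δ2l) < 1) (hη2 : 1/2 < η * (1 - δ2k))
    (xt : Fin n → ℝ) (It : Finset (Fin n)) (hIt : It.card = k) (hxt : lsSol A b It xt)
    (hf : 0 < obj A b xt)
    (z : Fin n → ℝ) (hz : z = fun i => xt i - η * Aᵀ.mulVec (A.mulVec xt - b) i)
    (hl1 : 1 ≤ l) (hlk : l ≤ k)
    (L : Finset (Fin n)) (hLsub : L ⊆ Itᶜ) (hLcard : L.card = l)
    (hLtop : ∀ j ∈ L, ∀ j' ∈ Itᶜ \ L, |z j'| ≤ |z j|)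
    (S : Finset (Fin n)) (hSsub : S ⊆ It ∪ L) (hScard : S.card = k)
    (hStop : ∀ j ∈ S, ∀ j' ∈ (It ∪ L) \ S, |z j'| ≤ |z j|)
    (xnext : Fin n → ℝ) (hxnext : lsSol A b S xnext)
    (c α : ℝ) (hc : c = min (4*η*(1-η)^2) (2*(2*η - 1/(1-δ2k))))
    (hα : α = c * (1/η - (1 + δ2l))) :
    0 < α ∧ obj A b xnext ≤ (1 - α * (l : ℝ)/(k : ℝ)) * obj A b xt := by
  subst hb
  have hδl := hRIP2l.1
  have hη1' : η < 1 := by nlinarith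
  have hδk : 0 < 1 - δ2k := by linarith [hRIP2k.2.1]
  have hc2 : 0 < 2*η - 1/(1-δ2k) := by
    rw [sub_pos, div_lt_iff₀ hδk]
    linarith
  have hcpos : 0 < c := by
    rw [hc]
    have : 0 < 1 - η := by linarith
    exact lt_min (by positivity) (by positivity)
  have hstep : 0 < 1/η - (1 + δ2l) := by
    rw [sub_pos, lt_div_iff₀ hη]
    linarith
  refine ⟨hα ▸ mul_pos hcpos hstep, ?_⟩
  have hv : ∀ i, 0 ≤ (z i)^2 := fun i => sq_nonneg _
  have hD := obj_le_sum_sq_sub_sum_sq hsp hIt hRIP2k hxt η hz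
  have hcD : c * obj A (A.mulVec xstar) xt
      ≤ ∑ i ∈ supp xstar, (z i)^2 - ∑ i ∈ It, (z i)^2 :=
    (mul_le_mul_of_nonneg_right (hc ▸ min_le_right _ _) hf.le).trans hD
  have hStop' : ∀ j ∈ S, ∀ j' ∈ (It ∪ L) \ S, (z j')^2 ≤ (z j)^2 :=
    fun j hj j' hj' => sq_le_sq.mpr (hStop j hj j' hj')
  have hQ := mul_sum_sub_sum_le_sum_sdiff hv (hScard ▸ hsp)
    (by omega) hLsub (fun j hj j' hj' => sq_le_sq.mpr (hLtop j hj j' hj')) hStop'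
    ((mul_pos hcpos hf).le.trans hcD)
  rw [hLcard, hScard] at hQ
  have hcl := (mul_le_mul_of_nonneg_left hcD (by positivity : (0 : ℝ) ≤ (l : ℝ) / k)).trans hQ
  have hle : ∑ i ∈ It \ S, (z i)^2 ≤ ∑ i ∈ S \ It, (z i)^2 := by
    have h := mul_sum_le_sum_of_top hv hStop' Finset.subset_union_left zero_le_one le_rfl
      (by simp [hIt, hScard])
    have h1 := Finset.sum_inter_add_sum_sdiff It S fun i => (z i)^2
    have h2 := Finset.sum_inter_add_sum_sdiff S It fun i => (z i)^2
    rw [Finset.inter_comm] at h2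
    linarith
  have hcard : (It \ S).card + (S \ It).card ≤ 2*l := by
    have h1 := Finset.card_inter_add_card_sdiff It S
    have h2 := Finset.card_inter_add_card_sdiff S It
    rw [Finset.inter_comm] at h2
    have h3 : S \ It ⊆ L := fun i hi => by
      rw [Finset.mem_sdiff] at hi
      exact (Finset.mem_union.mp (hSsub hi.1)).resolve_left hi.2
    have h4 := Finset.card_le_card h3
    omega
  have hy := obj_restr_le hRIP2l hη hxt hz hcard hle
  have hmin : obj A (A.mulVec xstar) xnext ≤ obj A (A.mulVec xstar) (restr z S) :=
    hxnext.obj_le (supp_subset_of_eq_zero fun i hi => by simp [restr, hi])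
  refine hmin.trans (hy.trans ?_)
  have hfin := mul_le_mul_of_nonneg_left hcl hstep.le
  have heq : (1 - α * (l : ℝ)/(k : ℝ)) * obj A (A.mulVec xstar) xt
      = obj A (A.mulVec xstar) xt
        - (1/η - (1 + δ2l)) * ((l : ℝ) / k * (c * obj A (A.mulVec xstar) xt)) := by
    rw [hα]; ring
  rw [heq]
  linarith
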